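/- arXiv:2111.10597 — 3 statements merged into one kernel-verified Lean document; each statement's English description precedes it below -/
import Mathlib

section
/- Let g : ℝ^d × ℝ^d → ℝ be continuously differentiable and satisfy the monotonicity condition (∂_x g(x,z) − ∂_x g(x,z̄))·(z − z̄) ≤ 0 for all x, z, z̄ ∈ ℝ^d. Let ρ : [0,∞) → [0,∞) be any function with ρ(0) = 0, and define the radial truncation π : ℝ^d → ℝ^d by π(z) = (ρ(|z|)/|z|) z for z ≠ 0 and π(0) = 0. Then the truncated function g̃(x,z) = g(x, π(z)) satisfies the weak monotonicity condition (∂_x g̃(x,z) − ∂_x g̃(x,0))·z ≤ 0 for all x, z ∈ ℝ^d, where ∂_x g̃(x,z) = ∂_x g(x, π(z)). -/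
open RealInnerProductSpace

/-- radial truncation preserves weak monotonicity: if `g` is C¹ and satisfies
`(∂ₓg(x,z) − ∂ₓg(x,z̄))·(z − z̄) ≤ 0`, and `π(z) = (ρ(|z|)/|z|)z` (with `π(0)=0`, `ρ(0)=0`,
`ρ ≥ 0` on `[0,∞)`), then `g̃(x,z) = g(x,π(z))` satisfies
`(∂ₓg̃(x,z) − ∂ₓg̃(x,0))·z ≤ 0`, where `∂ₓg̃(x,z) = ∂ₓg(x,π(z))`. -/
theorem truncation_preserves_weak_monotonicity {d : ℕ}
    (g : EuclideanSpace ℝ (Fin d) → EuclideanSpace ℝ (Fin d) → ℝ)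
    (hg : ContDiff ℝ 1
      (fun p : EuclideanSpace ℝ (Fin d) × EuclideanSpace ℝ (Fin d) => g p.1 p.2))
    (hmono : ∀ x z z' : EuclideanSpace ℝ (Fin d),
      ⟪gradient (fun x' => g x' z) x - gradient (fun x' => g x' z') x, z - z'⟫ ≤ 0)
    (ρ : ℝ → ℝ) (hρ0 : ρ 0 = 0) (hρ_nonneg : ∀ t : ℝ, 0 ≤ t → 0 ≤ ρ t)
    (π : EuclideanSpace ℝ (Fin d) → EuclideanSpace ℝ (Fin d))
    (hπ0 : π 0 = 0)
    (hπ : ∀ z : EuclideanSpace ℝ (Fin d), z ≠ 0 → π z = (ρ ‖z‖ / ‖z‖) • z) :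
    ∀ x z : EuclideanSpace ℝ (Fin d),
      ⟪gradient (fun x' => g x' (π z)) x - gradient (fun x' => g x' (π 0)) x, z⟫ ≤ 0 := by
  intro x z
  by_cases hz : z = 0
  · subst hz
    simp
  have h := hmono x (π z) 0
  have hc : 0 ≤ ρ ‖z‖ / ‖z‖ := div_nonneg (hρ_nonneg _ (norm_nonneg _)) (norm_nonneg _)
  have hp := hπ z hz
  rw [hπ0]
  rcases hc.eq_or_lt with h0 | hpos
  · rw [← h0, zero_smul] at hp
    rw [hp]
    simp
  · rw [sub_zero] at h
    have key : ∀ v : EuclideanSpace ℝ (Fin d), ⟪v, π z⟫ ≤ 0 → ⟪v, z⟫ ≤ 0 := by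
      intro v hv
      rw [hp, real_inner_smul_right] at hv
      exact nonpos_of_mul_nonpos_right hv hpos
    exact key _ h
end

section
/- Let r : ℝ^d × ℝ^d → ℝ be twice continuously differentiable and let â : ℝ^d × ℝ^d → ℝ^d be continuously differentiable and satisfy z + ∂_a r(x, â(x,z)) = 0 for all x, z ∈ ℝ^d, with ∂_a² r(x, â(x,z)) invertible for all x, z. Define H(x,z) = â(x,z)·z + r(x, â(x,z)). Then the mixed derivative of H satisfies ∂_z ∂_x H(x,z) = −∂_a ∂_x r(x, â(x,z)) (∂_a² r(x, â(x,z)))^{−1} for all x, z ∈ ℝ^d. -/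
open RealInnerProductSpace

/-- computation of the mixed derivative of the Hamiltonian:
`∂_z ∂_x H(x,z) = −∂ₐ∂ₓr(x, aStar(x,z)) (∂ₐ²r(x, aStar(x,z)))⁻¹`, where
`H(x,z) = aStar(x,z)·z + r(x, aStar(x,z))` and `aStar` satisfies the optimality
condition `z + ∂ₐr(x, aStar(x,z)) = 0`. -/
theorem mixed_deriv_hamiltonian {d : ℕ}
    (r : EuclideanSpace ℝ (Fin d) → EuclideanSpace ℝ (Fin d) → ℝ)
    (hr : ContDiff ℝ 2
      (fun p : EuclideanSpace ℝ (Fin d) × EuclideanSpace ℝ (Fin d) => r p.1 p.2))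
    (aStar : EuclideanSpace ℝ (Fin d) → EuclideanSpace ℝ (Fin d) → EuclideanSpace ℝ (Fin d))
    (haStar : ContDiff ℝ 1
      (fun p : EuclideanSpace ℝ (Fin d) × EuclideanSpace ℝ (Fin d) => aStar p.1 p.2))
    (hopt : ∀ x z : EuclideanSpace ℝ (Fin d),
      z + gradient (fun a => r x a) (aStar x z) = 0)
    (hinv : ∀ x z : EuclideanSpace ℝ (Fin d),
      IsUnit (fderiv ℝ (fun a => gradient (fun a' => r x a') a) (aStar x z)))
    (H : EuclideanSpace ℝ (Fin d) → EuclideanSpace ℝ (Fin d) → ℝ)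
    (hH : ∀ x z, H x z = ⟪aStar x z, z⟫ + r x (aStar x z)) :
    ∀ x z : EuclideanSpace ℝ (Fin d),
      fderiv ℝ (fun z' => gradient (fun x' => H x' z') x) z
        = -((fderiv ℝ (fun a => gradient (fun x' => r x' a) x) (aStar x z)).comp
            (Ring.inverse (fderiv ℝ (fun a => gradient (fun a' => r x a') a) (aStar x z)))) := by
  intro x z
  set rr : EuclideanSpace ℝ (Fin d) × EuclideanSpace ℝ (Fin d) → ℝ := fun p => r p.1 p.2 with hrr
  have hrd : Differentiable ℝ rr := hr.differentiable (by norm_num)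
  have hD : Differentiable ℝ (fderiv ℝ rr) :=
    (hr.fderiv_right (m := 1) (by norm_num)).differentiable (by norm_num)
  have had : Differentiable ℝ
      (fun p : EuclideanSpace ℝ (Fin d) × EuclideanSpace ℝ (Fin d) => aStar p.1 p.2) :=
    haStar.differentiable (by norm_num)
  have ha2 : ∀ x, Differentiable ℝ (fun z => aStar x z) := fun x =>
    had.comp (by fun_prop : Differentiable ℝ (fun z : EuclideanSpace ℝ (Fin d) => (x, z)))
  have ha1 : ∀ z, Differentiable ℝ (fun x => aStar x z) := fun z =>
    had.comp (by fun_prop : Differentiable ℝ (fun x : EuclideanSpace ℝ (Fin d) => (x, z)))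
  have h2 : ∀ x a, HasFDerivAt (fun a => r x a)
      ((fderiv ℝ rr (x, a)).comp (ContinuousLinearMap.inr ℝ _ _)) a := fun x a =>
    (hrd (x, a)).hasFDerivAt.comp a (hasFDerivAt_prodMk_right x a)
  have h1 : ∀ x a, HasFDerivAt (fun x => r x a)
      ((fderiv ℝ rr (x, a)).comp (ContinuousLinearMap.inl ℝ _ _)) x := fun x a =>
    (hrd (x, a)).hasFDerivAt.comp (f := fun x => (x, a)) x (hasFDerivAt_prodMk_left x a)
  have hDx : Differentiable ℝ (fun a => fderiv ℝ rr (x, a)) :=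
    hD.comp (by fun_prop : Differentiable ℝ (fun a : EuclideanSpace ℝ (Fin d) => (x, a)))
  have hF : Differentiable ℝ (fun a => gradient (fun a' => r x a') a) := by
    have : (fun a => gradient (fun a' => r x a') a) = fun a =>
        (InnerProductSpace.toDual ℝ (EuclideanSpace ℝ (Fin d))).symm
          ((fderiv ℝ rr (x, a)).comp (ContinuousLinearMap.inr ℝ _ _)) := by
      funext a
      rw [gradient, (h2 x a).fderiv]
    rw [this]
    exact (InnerProductSpace.toDual ℝ (EuclideanSpace ℝ (Fin d))).symm.differentiable.comp
      (hDx.clm_comp (differentiable_const _))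
  have hG : Differentiable ℝ (fun a => gradient (fun x' => r x' a) x) := by
    have : (fun a => gradient (fun x' => r x' a) x) = fun a =>
        (InnerProductSpace.toDual ℝ (EuclideanSpace ℝ (Fin d))).symm
          ((fderiv ℝ rr (x, a)).comp (ContinuousLinearMap.inl ℝ _ _)) := by
      funext a
      rw [gradient, (h1 x a).fderiv]
    rw [this]
    exact (InnerProductSpace.toDual ℝ (EuclideanSpace ℝ (Fin d))).symm.differentiable.comp
      (hDx.clm_comp (differentiable_const _))
  -- optimality in dual form
  have hoptd : ∀ x z v, fderiv ℝ rr (x, aStar x z) (0, v) = - ⟪v, z⟫ := by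
    intro x z v
    have h := hopt x z
    have h' : gradient (fun a => r x a) (aStar x z) = -z := by
      rw [eq_neg_iff_add_eq_zero, add_comm]; exact h
    have h3 : ⟪gradient (fun a => r x a) (aStar x z), v⟫ = fderiv ℝ rr (x, aStar x z) (0, v) := by
      rw [gradient, (h2 x _).fderiv, InnerProductSpace.toDual_symm_apply]
      simp
    rw [← h3, h', inner_neg_left, real_inner_comm]
  -- envelope
  have henv : (fun z' => gradient (fun x' => H x' z') x)
      = fun z' => gradient (fun x' => r x' (aStar x z')) x := by
    funext z'
    have hA := (ha1 z' x).hasFDerivAt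
    have hc := (hrd (x, aStar x z')).hasFDerivAt.comp (f := fun x => (x, aStar x z')) x
      ((hasFDerivAt_id x).prodMk hA)
    have hi := hA.inner ℝ (hasFDerivAt_const z' x)
    have hs := hi.add hc
    have hHe : (fun x' => H x' z') = fun x' => ⟪aStar x' z', z'⟫ + r x' (aStar x' z') := by
      funext x'; exact hH x' z'
    have hfd : HasFDerivAt (fun x' => H x' z')
        ((fderiv ℝ rr (x, aStar x z')).comp (ContinuousLinearMap.inl ℝ _ _)) x := by
      rw [hHe]
      refine HasFDerivAt.congr_fderiv hs ?_
      ext1 v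
      have e := hoptd x z' (fderiv ℝ (fun x => aStar x z') x v)
      have e2 : fderiv ℝ rr (x, aStar x z') (v, fderiv ℝ (fun x => aStar x z') x v)
          = fderiv ℝ rr (x, aStar x z') (v, 0)
            + fderiv ℝ rr (x, aStar x z') (0, fderiv ℝ (fun x => aStar x z') x v) := by
        rw [← map_add]; simp
      simp [fderivInnerCLM_apply, e2, e]
    rw [gradient, gradient, hfd.fderiv, (h1 x _).fderiv]
  rw [henv]
  have hA := (ha2 x z).hasFDerivAt
  have hGA := (hG (aStar x z)).hasFDerivAt.comp z hA
  have hFA := (hF (aStar x z)).hasFDerivAt.comp z hA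
  have hneg : ((fun a => gradient (fun a' => r x a') a) ∘ fun z => aStar x z) = fun z => -z := by
    funext z'
    have := hopt x z'
    simp only [Function.comp]
    rw [eq_neg_iff_add_eq_zero, add_comm]; exact this
  rw [hneg] at hFA
  have hid := hFA.unique (hasFDerivAt_id z).neg
  have hG' := hGA.fderiv
  simp only [Function.comp_def] at hG'
  rw [hG']
  set F' := fderiv ℝ (fun a => gradient (fun a' => r x a') a) (aStar x z) with hF'
  set A := fderiv ℝ (fun z => aStar x z) z with hA'
  have hAi : A = -Ring.inverse F' := by
    have hm : F' * A = -1 := hid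
    have hu : IsUnit F' := hinv x z
    have hl : Ring.inverse F' * F' = 1 := Ring.inverse_mul_cancel F' hu
    calc A = 1 * A := (one_mul A).symm
      _ = Ring.inverse F' * (F' * A) := by rw [← hl]; exact mul_assoc _ _ _
      _ = -Ring.inverse F' := by rw [hm]; ext1 v; exact map_neg (Ring.inverse F') v
  rw [hAi, ContinuousLinearMap.comp_neg]
end

section
/- Let r : ℝ^d × ℝ^d → ℝ be twice continuously differentiable and let â : ℝ^d × ℝ^d → ℝ^d be continuously differentiable and satisfy z + ∂_a r(x, â(x,z)) = 0 for all x, z ∈ ℝ^d, with ∂_a² r(x,a) invertible for all x, a. Define H(x,z) = â(x,z)·z + r(x, â(x,z)). If z^T ∂_a ∂_x r(x,a) (∂_a² r(x,a))^{−1} z ≥ 0 for all x, a, z ∈ ℝ^d, then H satisfies the monotonicity condition (∂_x H(x,z) − ∂_x H(x,z̄))·(z − z̄) ≤ 0 for all x, z, z̄ ∈ ℝ^d. -/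
open RealInnerProductSpace

/-- if `zᵀ ∂ₐ∂ₓr(x,a) (∂ₐ²r(x,a))⁻¹ z ≥ 0` for all `x, a, z`, then the
Hamiltonian `H(x,z) = aStar(x,z)·z + r(x, aStar(x,z))` satisfies the monotonicity
condition `(∂ₓH(x,z) − ∂ₓH(x,z̄))·(z − z̄) ≤ 0`. -/
theorem hamiltonian_monotonicity {d : ℕ}
    (r : EuclideanSpace ℝ (Fin d) → EuclideanSpace ℝ (Fin d) → ℝ)
    (hr : ContDiff ℝ 2
      (fun p : EuclideanSpace ℝ (Fin d) × EuclideanSpace ℝ (Fin d) => r p.1 p.2))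
    (aStar : EuclideanSpace ℝ (Fin d) → EuclideanSpace ℝ (Fin d) → EuclideanSpace ℝ (Fin d))
    (haStar : ContDiff ℝ 1
      (fun p : EuclideanSpace ℝ (Fin d) × EuclideanSpace ℝ (Fin d) => aStar p.1 p.2))
    (hopt : ∀ x z : EuclideanSpace ℝ (Fin d),
      z + gradient (fun a => r x a) (aStar x z) = 0)
    (hinv : ∀ x a : EuclideanSpace ℝ (Fin d),
      IsUnit (fderiv ℝ (fun a' => gradient (fun a'' => r x a'') a') a))
    (H : EuclideanSpace ℝ (Fin d) → EuclideanSpace ℝ (Fin d) → ℝ)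
    (hH : ∀ x z, H x z = ⟪aStar x z, z⟫ + r x (aStar x z))
    (hpos : ∀ x a z : EuclideanSpace ℝ (Fin d),
      0 ≤ ⟪(fderiv ℝ (fun a' => gradient (fun x' => r x' a') x) a)
          ((Ring.inverse (fderiv ℝ (fun a' => gradient (fun a'' => r x a'') a') a)) z), z⟫) :
    ∀ x z z' : EuclideanSpace ℝ (Fin d),
      ⟪gradient (fun x' => H x' z) x - gradient (fun x' => H x' z') x, z - z'⟫ ≤ 0 := by
  have hR1 : Differentiable ℝ
      (fun p : EuclideanSpace ℝ (Fin d) × EuclideanSpace ℝ (Fin d) => r p.1 p.2) :=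
    hr.differentiable (by norm_num)
  have hA1 : Differentiable ℝ
      (fun p : EuclideanSpace ℝ (Fin d) × EuclideanSpace ℝ (Fin d) => aStar p.1 p.2) :=
    haStar.differentiable (by norm_num)
  have hF : Differentiable ℝ (fderiv ℝ
      (fun p : EuclideanSpace ℝ (Fin d) × EuclideanSpace ℝ (Fin d) => r p.1 p.2)) :=
    (hr.fderiv_right (m := 1) (by norm_num)).differentiable (by norm_num)
  set F := fderiv ℝ
      (fun p : EuclideanSpace ℝ (Fin d) × EuclideanSpace ℝ (Fin d) => r p.1 p.2) with hFdef
  have hRF : ∀ p, HasFDerivAt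
      (fun p : EuclideanSpace ℝ (Fin d) × EuclideanSpace ℝ (Fin d) => r p.1 p.2) (F p) p :=
    fun p => (hR1 p).hasFDerivAt
  have hga : ∀ x a, gradient (fun a' => r x a') a = (InnerProductSpace.toDual ℝ _).symm
      ((F (x, a)).comp (ContinuousLinearMap.inr ℝ _ _)) := by
    intro x a
    have h := (hRF (x, a)).comp a (hasFDerivAt_prodMk_right (𝕜 := ℝ) x a)
    unfold gradient
    congr 1
    exact h.fderiv
  have hgx : ∀ x a, gradient (fun x' => r x' a) x = (InnerProductSpace.toDual ℝ _).symm
      ((F (x, a)).comp (ContinuousLinearMap.inl ℝ _ _)) := by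
    intro x a
    have h := (hRF (x, a)).comp x (hasFDerivAt_prodMk_left (𝕜 := ℝ) x a)
    unfold gradient
    congr 1
    exact h.fderiv
  have hFa : ∀ x, Differentiable ℝ (fun a => F (x, a)) := fun x =>
    hF.comp ((differentiable_const x).prodMk differentiable_id)
  have hdga : ∀ x, Differentiable ℝ (fun a => gradient (fun a' => r x a') a) := by
    intro x
    simp only [hga]
    exact (InnerProductSpace.toDual ℝ (EuclideanSpace ℝ (Fin d))).symm.toContinuousLinearEquiv.differentiable.comp
      ((hFa x).clm_comp (differentiable_const _))
  have hdgx : ∀ x, Differentiable ℝ (fun a => gradient (fun x' => r x' a) x) := by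
    intro x
    simp only [hgx]
    exact (InnerProductSpace.toDual ℝ (EuclideanSpace ℝ (Fin d))).symm.toContinuousLinearEquiv.differentiable.comp
      ((hFa x).clm_comp (differentiable_const _))
  have hax : ∀ z, Differentiable ℝ (fun x => aStar x z) := fun z =>
    hA1.comp (differentiable_id.prodMk (differentiable_const z))
  have haz : ∀ x, Differentiable ℝ (fun z => aStar x z) := fun x =>
    hA1.comp ((differentiable_const x).prodMk differentiable_id)
  have henv : ∀ x z, gradient (fun x' => H x' z) x
      = gradient (fun x' => r x' (aStar x z)) x := by
    intro x z
    have h1 := (hax z x).hasFDerivAt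
    have h2 := (hRF (x, aStar x z)).comp x ((hasFDerivAt_id x).prodMk h1)
    have h3 := h1.inner ℝ (hasFDerivAt_const z x)
    have h4 := h3.add h2
    have h5 : (fun x' => H x' z) = fun x' => ⟪aStar x' z, z⟫ + r x' (aStar x' z) := by
      funext x'; exact hH x' z
    rw [hgx]
    unfold gradient
    congr 1
    rw [h5]
    refine HasFDerivAt.fderiv (HasFDerivAt.congr_fderiv h4 ?_)
    ext v
    set u := fderiv ℝ (fun x => aStar x z) x v with hu
    have h6 : F (x, aStar x z) (0, u) = - ⟪u, z⟫ := by
      have h7 := hopt x z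
      rw [hga] at h7
      have h8 := congrArg (fun y => ⟪y, u⟫) h7
      simp only [inner_add_left, InnerProductSpace.toDual_symm_apply, inner_zero_left] at h8
      simp only [ContinuousLinearMap.comp_apply, ContinuousLinearMap.inr_apply] at h8
      rw [real_inner_comm]
      linarith
    have h9 : F (x, aStar x z) (v, u) = F (x, aStar x z) (v, 0) + F (x, aStar x z) (0, u) := by
      rw [← map_add]; simp
    simp [← hu, h9, h6, fderivInnerCLM_apply]
  have hder : ∀ x z w, (fderiv ℝ (fun z => aStar x z) z) w
      = - (Ring.inverse (fderiv ℝ (fun a' => gradient (fun a'' => r x a'') a') (aStar x z))) w := by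
    intro x z w
    set A := fderiv ℝ (fun a' => gradient (fun a'' => r x a'') a') (aStar x z) with hA
    have h1 := (hdga x (aStar x z)).hasFDerivAt.comp z (haz x z).hasFDerivAt
    have h2 := (hasFDerivAt_id z).add h1
    have h3 := h2.unique ((hasFDerivAt_const (0 : EuclideanSpace ℝ (Fin d)) z).congr_of_eventuallyEq
      (Filter.Eventually.of_forall fun y => hopt x y))
    have h4 := congrArg (fun L => Ring.inverse A (L w)) h3
    have h5 : ∀ y, Ring.inverse A (A y) = y := fun y => by
      have := congrArg (fun L => L y) (Ring.inverse_mul_cancel A (hinv x (aStar x z)))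
      simpa using this
    simp only [ContinuousLinearMap.add_apply, map_add, ContinuousLinearMap.comp_apply, ← hA, h5] at h4
    simp at h4
    exact eq_neg_of_add_eq_zero_right h4
  intro x z z'
  rw [henv, henv]
  set w := z - z' with hw
  have hφ : ∀ t : ℝ, HasDerivAt
      (fun t : ℝ => ⟪gradient (fun x' => r x' (aStar x (z' + t • w))) x, w⟫)
      (⟪(fderiv ℝ (fun a' => gradient (fun x' => r x' a') x) (aStar x (z' + t • w)))
        ((fderiv ℝ (fun z => aStar x z) (z' + t • w)) w), w⟫) t := by
    intro t
    have h0 : HasDerivAt (fun t : ℝ => z' + t • w) w t := by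
      simpa using ((hasDerivAt_id t).smul_const w).const_add z'
    have h1 := (haz x (z' + t • w)).hasFDerivAt.comp_hasDerivAt t h0
    have h2 := (hdgx x (aStar x (z' + t • w))).hasFDerivAt.comp_hasDerivAt t h1
    simpa using h2.inner ℝ (hasDerivAt_const t w)
  have hanti := antitone_of_hasDerivAt_nonpos hφ (fun t => by
    rw [hder, map_neg, inner_neg_left]
    exact neg_nonpos.2 (hpos _ _ _))
  have h01 := hanti (zero_le_one (α := ℝ))
  simp only [one_smul, zero_smul, add_zero] at h01
  rw [show z' + w = z by rw [hw]; abel] at h01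
  rw [inner_sub_left]
  linarith
end
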